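/- Let λ ≥ 2 and let t_0 ≥ t_1 ≥ … ≥ t_{λ−1} ≥ 0 be real numbers with t_0 = 1. Setting τ = Σ_{d=0}^{λ−1} t_d and τ_ℓ = Σ_{k=1}^{λ} t_{|ℓ−k|} for ℓ ∈ {1,…,λ}, it holds that τ_1 = τ_λ = τ, τ_ℓ < 2τ for every ℓ ∈ {2,…,λ−1}, and Σ_{ℓ=1}^{λ} τ_ℓ ≤ 2(λ−1)·τ. -/

import Mathlib

/-- The sum of `t` over the distances from `l` to the points of `range (l + 1 + m)`, split at `l`;
the distance `0` is counted on both sides. -/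
theorem sum_range_dist_add (t : ℕ → ℝ) (l m : ℕ) :
    ∑ k ∈ Finset.range (l + 1 + m), t (Nat.dist l k) + t 0 =
      ∑ d ∈ Finset.range (l + 1), t d + ∑ d ∈ Finset.range (m + 1), t d := by
  rw [Finset.sum_range_add, Finset.sum_range_succ' t m, ← Finset.sum_range_reflect t (l + 1),
    add_assoc]
  congr 1
  · refine Finset.sum_congr rfl fun k hk => ?_
    rw [Finset.mem_range] at hk
    congr 1
    unfold Nat.dist
    omega
  · congr 1
    refine Finset.sum_congr rfl fun k _ => ?_
    congr 1
    unfold Nat.dist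
    omega

/-- For λ ≥ 2 and a nonincreasing nonnegative tolerance vector
with t₀ = 1, setting τ = Σ_{d<λ} t_d and τ_ℓ = Σ_{k=1}^{λ} t_{|ℓ−k|}, we have
τ_1 = τ_λ = τ (here types are indexed by Fin λ, so type 1 is ℓ = 0 and type λ
is ℓ = λ−1), τ_ℓ < 2τ for every intermediate ℓ, and Σ_ℓ τ_ℓ ≤ 2(λ−1)τ. -/
theorem stmt_18 (lam : ℕ) (hlam : 2 ≤ lam) (t : ℕ → ℝ) (ht0 : t 0 = 1)
    (hmono : ∀ d, d + 1 < lam → t (d + 1) ≤ t d)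
    (hnn : ∀ d, d < lam → 0 ≤ t d)
    (tau : ℝ) (htau : tau = ∑ d ∈ Finset.range lam, t d) :
    (∑ k : Fin lam, t (Nat.dist 0 k.val)) = tau ∧
    (∑ k : Fin lam, t (Nat.dist (lam - 1) k.val)) = tau ∧
    (∀ ℓ : Fin lam, 0 < ℓ.val → ℓ.val < lam - 1 →
      (∑ k : Fin lam, t (Nat.dist ℓ.val k.val)) < 2 * tau) ∧
    (∑ ℓ : Fin lam, ∑ k : Fin lam, t (Nat.dist ℓ.val k.val)) ≤
      2 * ((lam : ℝ) - 1) * tau := by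
  have partial_le : ∀ m ≤ lam, ∑ d ∈ Finset.range m, t d ≤ tau := by
    intro m hm
    rw [htau]
    exact Finset.sum_le_sum_of_subset_of_nonneg (Finset.range_subset_range.2 hm)
      fun d hd _ => hnn d (Finset.mem_range.1 hd)
  simp only [fun l : ℕ => Fin.sum_univ_eq_sum_range (fun k => t (Nat.dist l k)) lam]
  rw [Fin.sum_univ_eq_sum_range (fun l => ∑ k ∈ Finset.range lam, t (Nat.dist l k)) lam]
  have first : ∑ k ∈ Finset.range lam, t (Nat.dist 0 k) = tau := by
    simp [htau, Nat.dist]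
  have last : ∑ k ∈ Finset.range lam, t (Nat.dist (lam - 1) k) = tau := by
    have h := sum_range_dist_add t (lam - 1) 0
    rw [Nat.add_zero, Nat.sub_add_cancel (by omega), Nat.zero_add, Finset.sum_range_one,
      ← htau] at h
    linarith
  have middle : ∀ l < lam, ∑ k ∈ Finset.range lam, t (Nat.dist l k) < 2 * tau := by
    intro l hl
    obtain ⟨m, rfl⟩ := Nat.exists_eq_add_of_le (Nat.succ_le_of_lt hl)
    have h := sum_range_dist_add t l m
    have h₁ := partial_le (l + 1) (by omega)
    have h₂ := partial_le (m + 1) (by omega)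
    rw [Nat.succ_eq_add_one]
    linarith
  refine ⟨first, last, fun l _ _ => middle l l.isLt, ?_⟩
  obtain ⟨n, rfl⟩ := Nat.exists_eq_add_of_le' hlam
  rw [Finset.sum_range_succ, Finset.sum_range_succ', first]
  have hlast : ∑ k ∈ Finset.range (n + 2), t (Nat.dist (n + 1) k) = tau := last
  rw [hlast]
  have h : ∑ l ∈ Finset.range n, ∑ k ∈ Finset.range (n + 2), t (Nat.dist (l + 1) k) ≤
      n * (2 * tau) := by
    refine (Finset.sum_le_card_nsmul _ _ (2 * tau) fun l hl => ?_).trans_eq (by simp)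
    rw [Finset.mem_range] at hl
    exact (middle (l + 1) (by omega)).le
  push_cast
  linarith
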